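/- For every integer i ≥ 2 with k = 2^i − 1 ≥ 3, the minimal binary Niven number satisfies a_k ≤ 2^{k + k⁻} + 2^k − 2^{k−i} − 1, where k⁻ is the least positive residue of −k modulo i. -/

import Mathlib

/-- `binDigitSum n` is the sum of the binary digits of `n`. -/
def binDigitSum (n : ℕ) : ℕ := (Nat.digits 2 n).sum

theorem binDigitSum_eq_mod_add_div (n : ℕ) : binDigitSum n = n % 2 + binDigitSum (n / 2) := by
  rcases n.eq_zero_or_pos with rfl | hn
  · simp [binDigitSum]
  · rw [binDigitSum, Nat.digits_def' one_lt_two hn, List.sum_cons, binDigitSum]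

theorem binDigitSum_add_two_pow_mul (m a b : ℕ) (ha : a < 2 ^ m) :
    binDigitSum (a + 2 ^ m * b) = binDigitSum a + binDigitSum b := by
  induction m generalizing a with
  | zero =>
    obtain rfl : a = 0 := by simpa using ha
    simp [binDigitSum]
  | succ m ih =>
    rw [pow_succ] at ha
    have hmul : 2 ^ (m + 1) * b = 2 * (2 ^ m * b) := by ring
    rw [binDigitSum_eq_mod_add_div, binDigitSum_eq_mod_add_div a, hmul, Nat.add_mul_mod_self_left,
      Nat.add_mul_div_left _ _ two_pos, ih (a / 2) (by omega), add_assoc]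

theorem binDigitSum_two_pow_mul (m b : ℕ) : binDigitSum (2 ^ m * b) = binDigitSum b := by
  simpa [binDigitSum] using binDigitSum_add_two_pow_mul m 0 b (by positivity)

theorem binDigitSum_two_pow (m : ℕ) : binDigitSum (2 ^ m) = 1 := by
  simpa [binDigitSum] using binDigitSum_two_pow_mul m 1

theorem binDigitSum_two_pow_sub_one (m : ℕ) : binDigitSum (2 ^ m - 1) = m := by
  induction m with
  | zero => simp [binDigitSum]
  | succ m ih =>
    have hpos : 0 < 2 ^ m := by positivity
    have hmod : (2 ^ (m + 1) - 1) % 2 = 1 := by rw [pow_succ]; omega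
    have hdiv : (2 ^ (m + 1) - 1) / 2 = 2 ^ m - 1 := by rw [pow_succ]; omega
    rw [binDigitSum_eq_mod_add_div, hmod, hdiv, ih, add_comm]

/-- Binary expansion of `2 ^ (m + j + 1 + r) + 2 ^ (m + j + 1) - 2 ^ m - 1`. -/
theorem two_pow_add_two_pow_sub_eq (m j r : ℕ) :
    2 ^ (m + (j + 1) + r) + 2 ^ (m + (j + 1)) - 2 ^ m - 1 =
      (2 ^ m - 1) + 2 ^ m * (2 ^ 1 * (2 ^ j - 1) + 2 ^ (j + 1) * 2 ^ r) := by
  obtain ⟨x, hx⟩ := Nat.exists_eq_add_of_le' (Nat.one_le_two_pow (n := m))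
  obtain ⟨y, hy⟩ := Nat.exists_eq_add_of_le' (Nat.one_le_two_pow (n := j))
  simp only [pow_add, pow_one, hx, hy, Nat.add_sub_cancel, Nat.sub_sub]
  apply Nat.sub_eq_of_eq_add
  ring

theorem binDigitSum_two_pow_add_two_pow_sub (m j r : ℕ) :
    binDigitSum (2 ^ (m + (j + 1) + r) + 2 ^ (m + (j + 1)) - 2 ^ m - 1) = m + (j + 1) := by
  have hm : 0 < 2 ^ m := by positivity
  have hj : 0 < 2 ^ j := by positivity
  rw [two_pow_add_two_pow_sub_eq, binDigitSum_add_two_pow_mul _ _ _ (by omega),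
    binDigitSum_add_two_pow_mul _ _ _ (by rw [pow_succ]; omega), binDigitSum_two_pow_mul,
    binDigitSum_two_pow_sub_one, binDigitSum_two_pow_sub_one, binDigitSum_two_pow]

theorem two_pow_sub_one_dvd_two_pow_add_two_pow_sub {m i r : ℕ} (h : i ∣ m + i + r) :
    2 ^ i - 1 ∣ 2 ^ (m + i + r) + 2 ^ (m + i) - 2 ^ m - 1 := by
  have hsplit : 2 ^ (m + i + r) + 2 ^ (m + i) - 2 ^ m - 1 =
      (2 ^ (m + i + r) - 1) + 2 ^ m * (2 ^ i - 1) := by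
    have hle : 2 ^ m ≤ 2 ^ (m + i) := Nat.pow_le_pow_right two_pos (by omega)
    have hpos : 0 < 2 ^ (m + i + r) := by positivity
    rw [Nat.mul_sub, mul_one, ← pow_add]
    omega
  rw [hsplit]
  exact dvd_add (Nat.pow_sub_one_dvd_pow_sub_one 2 h) (dvd_mul_left _ _)

/-- Theorem (upper bound for Mersenne indices): for `i ≥ 2` and `k = 2^i - 1 ≥ 3`,
the minimal binary Niven number `a_k` (smallest positive multiple of `k` with
binary digit sum `k`) satisfies `a_k ≤ 2^(k + k⁻) + 2^k - 2^(k-i) - 1`, where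
`k⁻` is the least positive residue of `-k` modulo `i`. -/
theorem ak_le_mersenne_bound
    (i k km : ℕ) (hi : 2 ≤ i) (hk : k = 2 ^ i - 1)
    (hkm1 : 1 ≤ km) (hkm2 : km ≤ i - 1) (hkm3 : i ∣ km + k)
    (a : ℕ) (ha : IsLeast {N : ℕ | 0 < N ∧ k ∣ N ∧ binDigitSum N = k} a) :
    a ≤ 2 ^ (k + km) + 2 ^ k - 2 ^ (k - i) - 1 := by
  have hik : i ≤ k := hk ▸ Nat.le_sub_one_of_lt Nat.lt_two_pow_self
  have hsum : binDigitSum (2 ^ (k + km) + 2 ^ k - 2 ^ (k - i) - 1) = k := by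
    have h := binDigitSum_two_pow_add_two_pow_sub (k - i) (i - 1) km
    rwa [Nat.sub_add_cancel (by omega : 1 ≤ i), Nat.sub_add_cancel hik] at h
  have hdvd : k ∣ 2 ^ (k + km) + 2 ^ k - 2 ^ (k - i) - 1 := by
    have h := two_pow_sub_one_dvd_two_pow_add_two_pow_sub (m := k - i) (i := i) (r := km)
      (by rwa [Nat.sub_add_cancel hik, add_comm])
    rwa [Nat.sub_add_cancel hik, ← hk] at h
  refine ha.2 ⟨Nat.pos_of_ne_zero fun h0 => ?_, hdvd, hsum⟩
  rw [h0] at hsum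
  simp only [binDigitSum, Nat.digits_zero, List.sum_nil] at hsum
  omega
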